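/- Suppose L carries a nondegenerate invariant bilinear form b (invariance meaning b(⁅x,y⁆,z) = b(x,⁅y,z⁆) for all x,y,z ∈ L). Then F(L) = L. In particular, if L is not abelian, then L does not admit a commutative polarization. -/

import Mathlib

open Module

noncomputable section

variable (k : Type*) [Field k]

/-- `L(f) = {x ∈ L | f ⁅x, y⁆ = 0 for all y ∈ L}`. -/
def lieStab (L : Type*) [LieRing L] [LieAlgebra k L] (f : Module.Dual k L) :
    Submodule k L where
  carrier := {x | ∀ y : L, f ⁅x, y⁆ = 0}
  add_mem' := fun {a b} ha hb y => by rw [add_lie, map_add, ha y, hb y, add_zero]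
  zero_mem' := fun y => by rw [zero_lie, map_zero]
  smul_mem' := fun c a ha y => by rw [smul_lie, map_smul, ha y, smul_zero]

/-- The index `i(L)`, the minimum of `dim L(f)` over all `f ∈ L*`. -/
def lieIndex (L : Type*) [LieRing L] [LieAlgebra k L] : ℕ :=
  ⨅ f : Module.Dual k L, finrank k (lieStab k L f)

/-- `f ∈ L*` is regular if `dim L(f) = i(L)`. -/
def LieIsRegular (L : Type*) [LieRing L] [LieAlgebra k L] (f : Module.Dual k L) : Prop :=
  finrank k (lieStab k L f) = lieIndex k L

/-- A commutative polarization of `L`: an abelian Lie subalgebra `P` with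
`2 dim P = dim L + i(L)`. -/
def IsCP (L : Type*) [LieRing L] [LieAlgebra k L] (P : LieSubalgebra k L) : Prop :=
  IsLieAbelian ↥P ∧ 2 * finrank k ↥P = finrank k L + lieIndex k L

/-- A CP-ideal of `L`: a CP which is also a Lie ideal of `L`. -/
def IsCPIdeal (L : Type*) [LieRing L] [LieAlgebra k L] (P : LieSubalgebra k L) : Prop :=
  IsCP k L P ∧ ∀ x y : L, y ∈ P → ⁅x, y⁆ ∈ P

/-- `L` is square integrable if `i(L) = dim Z(L)`. -/
def SquareIntegrable (L : Type*) [LieRing L] [LieAlgebra k L] : Prop :=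
  lieIndex k L = finrank k ↥(LieAlgebra.center k L)


/-- The Frobenius semiradical `F(L)`, the span of the union of the `L(f)` over regular `f`. -/
def frobSemiradical (L : Type*) [LieRing L] [LieAlgebra k L] : Submodule k L :=
  ⨆ f ∈ {f : Module.Dual k L | LieIsRegular k L f}, lieStab k L f

/-- Over an infinite field, some nonzero multiple of `B` can be added to `A` without enlarging
the dimension of the kernel. -/
theorem exists_ne_zero_finrank_ker_add_smul_le {k V W : Type*} [Field k] [Infinite k]
    [AddCommGroup V] [Module k V] [FiniteDimensional k V] [AddCommGroup W] [Module k W]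
    (A B : V →ₗ[k] W) :
    ∃ t : k, t ≠ 0 ∧ finrank k (LinearMap.ker (A + t • B)) ≤ finrank k (LinearMap.ker A) := by
  obtain ⟨U, hU⟩ := Submodule.exists_isCompl (LinearMap.ker A)
  have hinj : LinearMap.ker (A.domRestrict U) = ⊥ := by
    rw [LinearMap.ker_eq_bot']
    intro u hu
    have : (u : V) ∈ LinearMap.ker A ⊓ U := ⟨hu, u.2⟩
    rw [hU.inf_eq_bot] at this
    simpa using this
  obtain ⟨σ, hσ⟩ := LinearMap.exists_leftInverse_of_injective _ hinj
  set C : End k U := σ ∘ₗ B.domRestrict U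
  have hfin : {μ : k | C.HasEigenvalue μ}.Finite := Module.End.finite_hasEigenvalue C
  obtain ⟨μ, hμ⟩ := (hfin.insert 0).exists_notMem
  simp only [Set.mem_insert_iff, Set.mem_ofPred_eq, not_or] at hμ
  refine ⟨-μ⁻¹, by simpa using hμ.1, ?_⟩
  have hdisj : Disjoint (LinearMap.ker (A + (-μ⁻¹) • B)) U := by
    rw [Submodule.disjoint_def]
    intro u hu huU
    by_contra hne
    refine hμ.2 (Module.End.hasEigenvalue_of_hasEigenvector (x := ⟨u, huU⟩)
      ⟨Module.End.mem_eigenspace_iff.mpr ?_, by simpa using hne⟩)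
    have hA : A u = μ⁻¹ • B u := by
      simpa [add_neg_eq_zero] using hu
    have h1 : σ (A u) = ⟨u, huU⟩ := LinearMap.congr_fun hσ ⟨u, huU⟩
    rw [hA, map_smul] at h1
    change σ (B u) = _
    rw [← h1, smul_inv_smul₀ hμ.1]
  have h1 := Submodule.finrank_add_finrank_le_of_disjoint hdisj
  have h2 := Submodule.finrank_add_eq_of_isCompl hU
  omega

section

variable {k} {L : Type*} [LieRing L] [LieAlgebra k L]

theorem lieIndex_le_finrank_lieStab (f : Module.Dual k L) :
    lieIndex k L ≤ finrank k (lieStab k L f) :=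
  ciInf_le (OrderBot.bddBelow _) f

theorem exists_lieIsRegular : ∃ f : Module.Dual k L, LieIsRegular k L f :=
  Nat.sInf_mem (Set.range_nonempty fun f : Module.Dual k L => finrank k (lieStab k L f))

/-- With respect to an invariant form, the stabilizer of `b z` is the centralizer of `z`. -/
theorem lieStab_eq_ker_ad {b : LinearMap.BilinForm k L} (hb : b.Nondegenerate)
    (hinv : ∀ x y z : L, b ⁅x, y⁆ z = b x ⁅y, z⁆) (z : L) :
    lieStab k L (b z) = LinearMap.ker (LieAlgebra.ad k L z : L →ₗ[k] L) := by
  ext x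
  rw [LinearMap.mem_ker, LieAlgebra.ad_apply]
  refine ⟨fun hx => hb.1 _ fun y => (hinv z x y).trans (hx y), fun hx y => ?_⟩
  rw [← hinv, hx, map_zero, LinearMap.zero_apply]

theorem frobSemiradical_eq_top_of_nondegenerate [Infinite k] [FiniteDimensional k L]
    {b : LinearMap.BilinForm k L} (hb : b.Nondegenerate)
    (hinv : ∀ x y z : L, b ⁅x, y⁆ z = b x ⁅y, z⁆) : frobSemiradical k L = ⊤ := by
  have hstab := lieStab_eq_ker_ad hb hinv
  have hmem : ∀ z : L, LieIsRegular k L (b z) → z ∈ frobSemiradical k L := fun z hz =>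
    (le_iSup₂_of_le (b z) hz le_rfl : lieStab k L (b z) ≤ frobSemiradical k L)
      (by rw [hstab]; simp)
  obtain ⟨f, hf⟩ := exists_lieIsRegular (k := k) (L := L)
  obtain ⟨z, rfl⟩ := (b.toDual hb).surjective f
  replace hf : LieIsRegular k L (b z) := hf
  rw [eq_top_iff]
  intro w _
  obtain ⟨t, ht, hle⟩ := exists_ne_zero_finrank_ker_add_smul_le
    (LieAlgebra.ad k L z : L →ₗ[k] L) (LieAlgebra.ad k L w)
  have hreg : LieIsRegular k L (b (z + t • w)) := by
    refine le_antisymm ?_ (lieIndex_le_finrank_lieStab _)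
    rw [← hf, hstab, hstab, map_add, map_smul]
    exact hle
  have h := sub_mem (hmem _ hreg) (hmem _ hf)
  rw [add_sub_cancel_left] at h
  exact (Submodule.smul_mem_iff _ ht).mp h

/-- A commutative polarization contains the stabilizer of every regular functional. -/
theorem IsCP.lieStab_le [FiniteDimensional k L] {P : LieSubalgebra k L} (hP : IsCP k L P)
    {f : Module.Dual k L} (hf : LieIsRegular k L f) : lieStab k L f ≤ P.toSubmodule := by
  obtain ⟨hab, hdim⟩ := hP
  let φ : L →ₗ[k] Module.Dual k L :=
    (LinearMap.compRight k f) ∘ₗ (LieAlgebra.ad k L : L →ₗ[k] End k L)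
  have hker : LinearMap.ker φ = lieStab k L f := by
    ext x
    exact LinearMap.ext_iff
  have hmap : P.toSubmodule.map φ ≤ P.toSubmodule.dualAnnihilator := by
    rintro _ ⟨x, hx, rfl⟩
    rw [Submodule.mem_dualAnnihilator]
    intro y hy
    have h : ⁅x, y⁆ = 0 := congrArg Subtype.val (hab.trivial ⟨x, hx⟩ ⟨y, hy⟩)
    change f ⁅x, y⁆ = 0
    rw [h, map_zero]
  have h1 := Submodule.finrank_mono hmap
  have h2 := Subspace.finrank_add_finrank_dualAnnihilator_eq P.toSubmodule
  have h3 := (φ.domRestrict P.toSubmodule).finrank_range_add_finrank_ker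
  rw [LinearMap.range_domRestrict, LinearMap.ker_domRestrict, hker,
    LinearEquiv.finrank_eq (Submodule.equivMapOfInjective _ P.toSubmodule.injective_subtype _),
    Submodule.map_comap_subtype] at h3
  have h4 : finrank k P = finrank k P.toSubmodule := rfl
  have h5 : finrank k (lieStab k L f) = lieIndex k L := hf
  have h6 := Submodule.eq_of_le_of_finrank_le
    (inf_le_right : P.toSubmodule ⊓ lieStab k L f ≤ lieStab k L f) (by omega)
  exact inf_eq_right.mp h6

theorem IsCP.frobSemiradical_le [FiniteDimensional k L] {P : LieSubalgebra k L}
    (hP : IsCP k L P) : frobSemiradical k L ≤ P.toSubmodule :=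
  iSup₂_le fun _ hf => hP.lieStab_le hf

end

/-- **Theorem 3.2.** If `L` carries a nondegenerate invariant bilinear form then `F(L) = L`;
in particular a nonabelian such `L` admits no commutative polarization. -/
theorem frobSemiradical_eq_top_of_invariant_form {k L : Type*} [Field k] [CharZero k]
    [LieRing L] [LieAlgebra k L] [FiniteDimensional k L]
    (b : LinearMap.BilinForm k L) (hb : b.Nondegenerate)
    (hinv : ∀ x y z : L, b ⁅x, y⁆ z = b x ⁅y, z⁆) :
    frobSemiradical k L = ⊤ ∧
    (¬ IsLieAbelian L → ¬ ∃ P : LieSubalgebra k L, IsCP k L P) := by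
  have htop := frobSemiradical_eq_top_of_nondegenerate hb hinv
  refine ⟨htop, fun hL => ?_⟩
  rintro ⟨P, hP⟩
  have hmem : ∀ x : L, x ∈ P := fun x => hP.frobSemiradical_le (htop ▸ Submodule.mem_top)
  exact hL ⟨fun x y => congrArg Subtype.val (hP.1.trivial ⟨x, hmem x⟩ ⟨y, hmem y⟩)⟩

end
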